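/- There are no integers t ≥ 2 and a ≥ 0 satisfying (2t⁶ - 6t⁵ + 8t⁴ - 2t³ - 5t² + 5t - 1 + 2a)(2t⁶ - 6t⁵ + 8t⁴ - 2t³ - 5t² + 5t - 1 - 2a) = 5t⁴ - 14t³ + 19t² - 10t - 3. -/

import Mathlib

theorem stmt_13 : ¬ ∃ t a : ℤ, 2 ≤ t ∧ 0 ≤ a ∧
    (2 * t ^ 6 - 6 * t ^ 5 + 8 * t ^ 4 - 2 * t ^ 3 - 5 * t ^ 2 + 5 * t - 1 + 2 * a) *
        (2 * t ^ 6 - 6 * t ^ 5 + 8 * t ^ 4 - 2 * t ^ 3 - 5 * t ^ 2 + 5 * t - 1 - 2 * a) =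
      5 * t ^ 4 - 14 * t ^ 3 + 19 * t ^ 2 - 10 * t - 3 := by
  rintro ⟨t, a, ht, ha, h⟩
  obtain ⟨s, rfl⟩ : ∃ s, t = s + 2 := ⟨t - 2, by ring⟩
  have hs : 0 ≤ s := by linarith
  have hP : 2 * (s+2) ^ 6 - 6 * (s+2) ^ 5 + 8 * (s+2) ^ 4 - 2 * (s+2) ^ 3 - 5 * (s+2) ^ 2
      + 5 * (s+2) - 1
      = 2*s^6 + 18*s^5 + 68*s^4 + 142*s^3 + 175*s^2 + 121*s + 37 := by ring
  have hR : 5 * (s+2) ^ 4 - 14 * (s+2) ^ 3 + 19 * (s+2) ^ 2 - 10 * (s+2) - 3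
      = 5*s^4 + 26*s^3 + 55*s^2 + 58*s + 21 := by ring
  rw [hP, hR] at h
  have hPpos : 0 < 2*s^6 + 18*s^5 + 68*s^4 + 142*s^3 + 175*s^2 + 121*s + 37 := by positivity
  have hRpos : 0 < 5*s^4 + 26*s^3 + 55*s^2 + 58*s + 21 := by positivity
  have hD : 0 < 4*s^6 + 36*s^5 + 131*s^4 + 258*s^3 + 295*s^2 + 184*s + 52 := by positivity
  have hx : 0 < 2*s^6 + 18*s^5 + 68*s^4 + 142*s^3 + 175*s^2 + 121*s + 37 + 2 * a := by linarith
  have hy : 0 < 2*s^6 + 18*s^5 + 68*s^4 + 142*s^3 + 175*s^2 + 121*s + 37 - 2 * a :=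
    pos_of_mul_pos_right (h ▸ hRpos) hx.le
  have key := mul_nonneg (Int.sub_nonneg_of_le (Int.add_one_le_of_lt hx))
    (Int.sub_nonneg_of_le (Int.add_one_le_of_lt hy))
  simp only [zero_add] at key
  rw [sub_mul, mul_sub, h] at key
  linarith
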